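/- arXiv:math/0201001 — 2 statements merged into one kernel-verified Lean document; each statement's English description precedes it below -/
import Mathlib

section
/- Let (M, E: M → B) be a B-probability space, let D ⊂ B be a unital subalgebra, and let F: B → D be a conditional expectation satisfying the faithfulness condition: if b₁ ∈ B and F(b₁b₂) = 0 for all b₂ ∈ B, then b₁ = 0. Let N ⊂ M be a subalgebra containing D. Then N is free from B with amalgamation over D if and only if κ^B(n_1 b_1, n_2 b_2, …, n_k) = F( κ^B(n_1 F(b_1), n_2 F(b_2), …, n_k) ) for all k and all n_1,…,n_k ∈ N, b_1,…,b_{k-1} ∈ B; equivalently, if and only if κ^B(n_1 b_1, n_2 b_2, …, n_k) = κ^D(n_1 F(b_1), n_2 F(b_2), …, n_k) for all such arguments, where κ^D is the cumulant function of the D-probability space (M, F∘E). -/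
/-!  Statement 5 (Theorem 3.6):  a subalgebra `N ⊇ D` is free from `B` with amalgamation over `D` iff the `B`-valued cumulants of words `n₁b₁, n₂b₂, …, n_k` factorize through `F`, equivalently iff they are given by `D`-valued cumulants of the `F`-compressed words. -/

open scoped Classical

noncomputable section

namespace OVD

variable {M : Type*} [Ring M] [Algebra ℂ M]

/-- The (ordered) product of the `m i` over the indices `i` with `a < i < b`. -/
def gapProd {n : ℕ} (m : Fin n → M) (a b : ℕ) : M :=
  (((List.finRange n).filter (fun i : Fin n => decide (a < (i : ℕ) ∧ (i : ℕ) < b))).map m).prod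

/-- `E : M → M` is a conditional expectation onto the unital subalgebra `B`. -/
def IsCondExp (B : Subalgebra ℂ M) (E : M →ₗ[ℂ] M) : Prop :=
  E 1 = 1 ∧ (∀ x, E x ∈ B) ∧ ∀ b ∈ B, ∀ b' ∈ B, ∀ x, E (b * x * b') = b * E x * b'

/-- `κ` is the family of operator-valued cumulant functionals for the
`B`-probability space `(M, E)`:  the maps are multilinear, take values in `B`,
and satisfy the moment-cumulant recursion
`E(m₁⋯mₙ) = ∑_{π ∈ NC(n)} κ_π(m₁,…,mₙ)`, written in its equivalent recursive
form obtained by summing over the block `S` of the first element of a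
non-crossing partition (the inner gaps between consecutive elements of `S`
contribute nested moments, and the part after the last element of `S`
contributes an outer moment factor). -/
structure IsCumulantFamily (B : Subalgebra ℂ M) (E : M →ₗ[ℂ] M)
    (κ : ∀ n : ℕ, MultilinearMap ℂ (fun _ : Fin n => M) M) : Prop where
  mem : ∀ (n : ℕ) (x : Fin n → M), κ n x ∈ B
  moment : ∀ (n : ℕ) (x : Fin (n + 1) → M),
    E ((List.ofFn x).prod) =
      ∑ S : Finset (Fin (n + 1)),
        if hS : (0 : Fin (n + 1)) ∈ S then
          (κ S.card fun j =>
            if h : (j : ℕ) + 1 < S.card then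
              x ((S.orderIsoOfFin rfl) j) *
                E (gapProd x (((S.orderIsoOfFin rfl) j : Fin (n + 1)) : ℕ)
                  (((S.orderIsoOfFin rfl) ⟨(j : ℕ) + 1, h⟩ : Fin (n + 1)) : ℕ))
            else x ((S.orderIsoOfFin rfl) j)) *
          E (gapProd x
            (((S.orderIsoOfFin rfl)
                ⟨S.card - 1, Nat.sub_lt (Finset.card_pos.mpr ⟨0, hS⟩) Nat.one_pos⟩ :
              Fin (n + 1)) : ℕ)
            (n + 1))
        else 0

/-- The cumulant series of the family `X`:
`k_{i₁,…,i_{k+1}}(b₁,…,b_k) = κ(X_{i₁} b₁, X_{i₂} b₂, …, X_{i_{k+1}})`. -/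
def cumulantSeries (κ : ∀ n : ℕ, MultilinearMap ℂ (fun _ : Fin n => M) M)
    {ι : Type*} (X : ι → M) {k : ℕ} (i : Fin (k + 1) → ι) (b : Fin k → M) : M :=
  κ (k + 1) fun j => if h : (j : ℕ) < k then X (i j) * b ⟨(j : ℕ), h⟩ else X (i j)

/-- Two subsets `S₁, S₂` of `A` (each thought of as a subalgebra containing the
base algebra) are free with amalgamation with respect to the conditional
expectation `E` (valued in the module `W`):  every alternating product of
`E`-centered elements is `E`-centered. -/
def IsFreeWithAmalgamation {A W : Type*} [Ring A] [Algebra ℂ A]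
    [AddCommGroup W] [Module ℂ W] (E : A →ₗ[ℂ] W) (S₁ S₂ : Set A) : Prop :=
  ∀ (k : ℕ), 0 < k → ∀ (a : Fin k → A) (f : Fin k → Bool),
    (∀ j, a j ∈ (if f j then S₁ else S₂)) →
    (∀ j, E (a j) = 0) →
    (∀ (j : ℕ) (h : j + 1 < k), f ⟨j, Nat.lt_of_succ_lt h⟩ ≠ f ⟨j + 1, h⟩) →
    E ((List.ofFn a).prod) = 0

/-- The value of a family of multilinear maps on the entries of a list. -/
def onList (κ : ∀ n : ℕ, MultilinearMap ℂ (fun _ : Fin n => M) M) (l : List M) : M :=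
  κ l.length l.get

theorem onList_eq (κ : ∀ n : ℕ, MultilinearMap ℂ (fun _ : Fin n => M) M) {n : ℕ} {l : List M}
    (h : l.length = n) {f : Fin n → M} (hf : ∀ i : Fin n, l[(i : ℕ)] = f i) :
    onList κ l = κ n f := by
  subst h
  exact congrArg _ (funext hf)

/-- `onList κ` as a linear map of one list entry. -/
def onListLin (κ : ∀ n : ℕ, MultilinearMap ℂ (fun _ : Fin n => M) M) (u v : List M) :
    M →ₗ[ℂ] M :=
  (κ (u.length + (v.length + 1))).toLinearMap
    (fun i => (u ++ 0 :: v)[(i : ℕ)]'(by simp)) ⟨u.length, by omega⟩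

theorem onListLin_apply (κ : ∀ n : ℕ, MultilinearMap ℂ (fun _ : Fin n => M) M) (u v : List M)
    (a : M) : onListLin κ u v a = onList κ (u ++ a :: v) := by
  symm
  refine onList_eq κ (by simp) fun i => ?_
  by_cases h : (i : ℕ) = u.length
  · have : i = ⟨u.length, by omega⟩ := Fin.ext h
    rw [this]
    simp
  · have : i ≠ ⟨u.length, by omega⟩ := fun h' => h (congrArg Fin.val h')
    rw [Function.update_of_ne this]
    rcases Nat.lt_or_gt_of_ne h with h' | h'
    · simp [List.getElem_append_left h']
    · obtain ⟨m, hm⟩ : ∃ m, (i : ℕ) - u.length = m + 1 := ⟨i - u.length - 1, by omega⟩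
      rw [List.getElem_append_right h'.le, List.getElem_append_right h'.le]
      simp only [hm, List.getElem_cons_succ]

omit [Algebra ℂ M] in
theorem gapProd_eq_range {n : ℕ} (m : Fin n → M) (a b : ℕ) :
    gapProd m a b = (((List.range n).filter (fun i => decide (a < i ∧ i < b))).map
      (fun i => if h : i < n then m ⟨i, h⟩ else 0)).prod := by
  rw [gapProd, ← List.map_coe_finRange_eq_range, List.filter_map, List.map_map]
  congr 2
  funext i
  simp

omit [Algebra ℂ M] in
theorem gapProd_succ_self {n : ℕ} (m : Fin n → M) (a : ℕ) : gapProd m a (a + 1) = 1 := by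
  rw [gapProd, List.filter_eq_nil_iff.2]
  · simp
  · intro i _
    simp only [decide_eq_true_eq]
    omega

omit [Algebra ℂ M] in
theorem gapProd_succ {n : ℕ} (m : Fin n → M) {a b : ℕ} (hab : a < b) (hb : b < n) :
    gapProd m a (b + 1) = gapProd m a b * m ⟨b, hb⟩ := by
  obtain ⟨c, rfl⟩ : ∃ c, n = b + 1 + c := ⟨n - (b + 1), by omega⟩
  rw [gapProd_eq_range, gapProd_eq_range, List.range_add, List.range_succ]
  have h1 : (List.range b).filter (fun i => decide (a < i ∧ i < b + 1)) =
      (List.range b).filter (fun i => decide (a < i ∧ i < b)) := by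
    refine List.filter_congr fun i hi => ?_
    rw [List.mem_range] at hi
    simp only [decide_eq_decide]
    omega
  have h2 : ∀ d, d ≤ b + 1 →
      ((List.range c).map (fun i => b + 1 + i)).filter (fun i => decide (a < i ∧ i < d)) = [] := by
    intro d hd
    rw [List.filter_eq_nil_iff]
    intro i hi
    simp only [List.mem_map, List.mem_range] at hi
    obtain ⟨j, -, rfl⟩ := hi
    simp only [decide_eq_true_eq]
    omega
  simp only [List.filter_append, h1, h2 _ le_rfl, h2 b (by omega)]
  simp [hab, hb]

/-- Sum over the ways to extend a block whose last element is `y` (with `g` the product of the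
letters skipped so far, and `u` the earlier entries of the block) along the remaining letters;
`Z` evaluates the outcome. -/
def extendBlock (E : M →ₗ[ℂ] M) (Z : List M → M → M → M) : List M → M → M → List M → M
  | u, y, g, [] => Z u y g
  | u, y, g, q :: p => extendBlock E Z u y (g * q) p + extendBlock E Z (u ++ [y * E g]) q 1 p

section bridge

variable {n : ℕ} (E : M →ₗ[ℂ] M) (κ : ∀ n : ℕ, MultilinearMap ℂ (fun _ : Fin n => M) M)
  (x : Fin (n + 1) → M)

/-- The entries of the cumulant attached to a block, listed by its indices. -/
def blockEntries : List (Fin (n + 1)) → List M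
  | [] => []
  | [s] => [x s]
  | s :: t :: l => x s * E (gapProd x s t) :: blockEntries (t :: l)

/-- The contribution of the block with indices `s :: l`, preceded by the entries `u`. -/
def blockTerm : List M → Fin (n + 1) → List (Fin (n + 1)) → M
  | u, s, [] => onList κ (u ++ [x s]) * E (gapProd x s (n + 1))
  | u, s, t :: l => blockTerm (u ++ [x s * E (gapProd x s t)]) t l

theorem blockTerm_eq {l L : List (Fin (n + 1))} {u : List M} {s : Fin (n + 1)}
    (hL : L = s :: l) : blockTerm E κ x u s l =
      onList κ (u ++ blockEntries E x L) *
        E (gapProd x (L.getLast (by simp [hL]) : Fin (n + 1)) (n + 1)) := by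
  subst hL
  induction l generalizing u s with
  | nil => rfl
  | cons t l ih => simp [blockTerm, ih, blockEntries]

theorem length_blockEntries : ∀ l : List (Fin (n + 1)), (blockEntries E x l).length = l.length
  | [] => rfl
  | [s] => rfl
  | s :: t :: l => by simp [blockEntries, length_blockEntries (t :: l)]

theorem getElem_blockEntries : ∀ (l : List (Fin (n + 1))) (j : ℕ) (h : j < l.length),
    (blockEntries E x l)[j]'(by rwa [length_blockEntries]) =
      if h' : j + 1 < l.length then x l[j] * E (gapProd x l[j] l[j + 1]) else x l[j]
  | [], _, h => by simp at h
  | [s], 0, h => by simp [blockEntries]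
  | [s], j + 1, h => by simp at h
  | s :: t :: l, 0, h => by simp [blockEntries]
  | s :: t :: l, j + 1, h => by
      have := getElem_blockEntries (t :: l) j (by simpa using h)
      simp only [blockEntries, List.getElem_cons_succ, this, List.length_cons,
        Nat.add_lt_add_iff_right]

theorem extendBlock_eq_sum (w : List M) : ∀ (t : ℕ), w = (List.ofFn x).drop t →
    ∀ (u : List M) (s : Fin (n + 1)), (s : ℕ) < t → t ≤ n + 1 →
    extendBlock E (fun u y g => onList κ (u ++ [y]) * E g) u (x s) (gapProd x s t) w =
      ∑ R ∈ (Finset.univ.filter fun i : Fin (n + 1) => t ≤ i).powerset,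
        blockTerm E κ x u s (R.sort (· ≤ ·)) := by
  induction w with
  | nil =>
    intro t hw u s hst ht
    have : t = n + 1 := by
      have := congrArg List.length hw
      simp at this
      omega
    subst this
    have : (Finset.univ.filter fun i : Fin (n + 1) => n + 1 ≤ (i : ℕ)) = ∅ := by
      ext i; simp; omega
    rw [this]
    simp [extendBlock, blockTerm]
  | cons q w ih =>
    intro t hw u s hst ht
    have htn : t < n + 1 := by
      have := congrArg List.length hw
      simp at this
      omega
    rw [List.drop_eq_getElem_cons (by simpa using htn)] at hw
    obtain ⟨rfl, hw'⟩ := List.cons.inj hw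
    set A := Finset.univ.filter fun i : Fin (n + 1) => t + 1 ≤ (i : ℕ) with hA
    have hset : (Finset.univ.filter fun i : Fin (n + 1) => t ≤ (i : ℕ)) =
        insert (⟨t, htn⟩ : Fin (n + 1)) A := by
      ext i
      simp only [hA, Finset.mem_filter, Finset.mem_univ, true_and, Finset.mem_insert,
        Fin.ext_iff]
      omega
    have hnot : (⟨t, htn⟩ : Fin (n + 1)) ∉ A := by simp [hA]
    rw [hset, Finset.sum_powerset_insert hnot, extendBlock]
    congr 1
    · rw [← ih (t + 1) hw' u s (by omega) (by omega), gapProd_succ x hst htn]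
      simp only [List.getElem_ofFn]
    · have h := ih (t + 1) hw' (u ++ [x s * E (gapProd x s t)]) ⟨t, htn⟩ (by simp) (by omega)
      simp only [gapProd_succ_self] at h
      simp only [List.getElem_ofFn]
      rw [h]
      refine Finset.sum_congr rfl fun R hR => ?_
      rw [Finset.mem_powerset] at hR
      rw [Finset.sort_insert, blockTerm]
      · intro b hb
        have := hR hb
        simp only [hA, Finset.mem_filter, Finset.mem_univ, true_and] at this
        exact Fin.le_def.2 (by simp; omega)
      · exact fun h => hnot (hR h)

end bridge

theorem IsCumulantFamily.moment_list {B : Subalgebra ℂ M} {E : M →ₗ[ℂ] M}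
    {κ : ∀ n : ℕ, MultilinearMap ℂ (fun _ : Fin n => M) M} (hκ : IsCumulantFamily B E κ)
    (y : M) (p : List M) :
    E (y * p.prod) = extendBlock E (fun u y g => onList κ (u ++ [y]) * E g) [] y 1 p := by
  obtain ⟨n, x, rfl, rfl⟩ : ∃ (n : ℕ) (x : Fin (n + 1) → M), y = x 0 ∧
      p = (List.ofFn x).drop 1 :=
    ⟨p.length, Fin.cons y p.get, by simp, by simp [List.ofFn_succ]⟩
  have h := extendBlock_eq_sum E κ x _ 1 rfl [] 0 (by simp) (by omega)
  have h0 : gapProd x ((0 : Fin (n + 1)) : ℕ) 1 = 1 := gapProd_succ_self x 0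
  rw [h0] at h
  rw [h]
  have h1 : x 0 * ((List.ofFn x).drop 1).prod = (List.ofFn x).prod := by
    simp [List.ofFn_succ]
  rw [h1, hκ.moment]
  set A := Finset.univ.filter fun i : Fin (n + 1) => 1 ≤ (i : ℕ) with hA
  have hset : (Finset.univ : Finset (Finset (Fin (n + 1)))) = (insert 0 A).powerset := by
    ext S
    simp only [Finset.mem_univ, Finset.mem_powerset, true_iff]
    intro i _
    simp only [hA, Finset.mem_filter, Finset.mem_univ, true_and, Finset.mem_insert,
        Fin.ext_iff, Fin.val_zero]
    omega
  have hnot : (0 : Fin (n + 1)) ∉ A := by simp [hA]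
  rw [hset, Finset.sum_powerset_insert hnot, Finset.sum_eq_zero, zero_add]
  · refine Finset.sum_congr rfl fun R hR => ?_
    rw [Finset.mem_powerset] at hR
    rw [dif_pos (Finset.mem_insert_self _ _)]
    have hsort : (insert 0 R).sort (· ≤ ·) = 0 :: R.sort (· ≤ ·) :=
      Finset.sort_insert _ (fun b _ => Fin.zero_le b) (fun h => hnot (hR h))
    rw [blockTerm_eq E κ x hsort, List.nil_append]
    congr 1
    · symm
      refine onList_eq κ (by rw [length_blockEntries, Finset.length_sort]) fun i => ?_
      rw [getElem_blockEntries _ _ _ _ (by rw [Finset.length_sort]; exact i.2)]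
      simp only [Finset.length_sort, Finset.coe_orderIsoOfFin_apply, Finset.orderEmbOfFin_apply]
      rfl
    · congr 3
      simp only [Finset.coe_orderIsoOfFin_apply, Finset.orderEmbOfFin_apply]
      rw [List.getLast_eq_getElem]
      simp
  · intro R hR
    rw [Finset.mem_powerset] at hR
    rw [dif_neg fun h => hnot (hR h)]

namespace IsCondExp

variable {B : Subalgebra ℂ M} {E : M →ₗ[ℂ] M}

theorem map_mul_left (hE : IsCondExp B E) {b : M} (hb : b ∈ B) (m : M) : E (b * m) = b * E m := by
  simpa using hE.2.2 b hb 1 B.one_mem m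

theorem map_mul_right (hE : IsCondExp B E) {b : M} (hb : b ∈ B) (m : M) :
    E (m * b) = E m * b := by
  simpa using hE.2.2 1 B.one_mem b hb m

theorem map_eq_self (hE : IsCondExp B E) {b : M} (hb : b ∈ B) : E b = b := by
  simpa [hE.1] using hE.map_mul_left hb 1

end IsCondExp

section extendBlock

variable (E : M →ₗ[ℂ] M)

theorem extendBlock_append_singleton (Z : List M → M → M → M) (q : M) (p : List M) :
    ∀ (u : List M) (y g : M), extendBlock E Z u y g (p ++ [q]) =
      extendBlock E (fun u y g => Z u y (g * q) + Z (u ++ [y * E g]) q 1) u y g p := by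
  induction p with
  | nil => intro u y g; rfl
  | cons r p ih => intro u y g; simp only [List.cons_append, extendBlock, ih]

theorem extendBlock_sub_sum {ι : Type*} (s : Finset ι) (Z : List M → M → M → M)
    (Z' : ι → List M → M → M → M) (p : List M) : ∀ (u : List M) (y g : M),
    extendBlock E (fun u y g => Z u y g - ∑ i ∈ s, Z' i u y g) u y g p =
      extendBlock E Z u y g p - ∑ i ∈ s, extendBlock E (Z' i) u y g p := by
  induction p with
  | nil => intro u y g; rfl
  | cons r p ih =>
    intro u y g
    simp only [extendBlock, ih, Finset.sum_add_distrib]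
    abel

end extendBlock

section cumulants

variable {B : Subalgebra ℂ M} {E : M →ₗ[ℂ] M}
  {κ : ∀ n : ℕ, MultilinearMap ℂ (fun _ : Fin n => M) M}

theorem IsCumulantFamily.onList_mem (hκ : IsCumulantFamily B E κ) (l : List M) :
    onList κ l ∈ B :=
  hκ.mem _ _

theorem IsCumulantFamily.onList_singleton (hE : IsCondExp B E) (hκ : IsCumulantFamily B E κ)
    (y : M) : onList κ [y] = E y := by
  simpa [extendBlock, hE.1] using (hκ.moment_list y []).symm

theorem extendBlock_mul_right (hE : IsCondExp B E) {y b : M} (hb : b ∈ B)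
    (w : List M) : ∀ (u : List M) (y₀ g : M),
    (∀ u' : List M, u'.length < u.length + 1 + w.length →
      onList κ (u' ++ [y * b]) = onList κ (u' ++ [y]) * b) →
    extendBlock E (fun u y g => onList κ (u ++ [y]) * E g) u y₀ g (w ++ [y * b]) -
        extendBlock E (fun u y g => onList κ (u ++ [y]) * E g) u y₀ g (w ++ [y]) * b =
      onList κ (u ++ y₀ * E g :: w ++ [y * b]) - onList κ (u ++ y₀ * E g :: w ++ [y]) * b := by
  induction w with
  | nil =>
    intro u y₀ g _
    simp [extendBlock, hE.1, add_mul, mul_assoc, ← hE.map_mul_right hb]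
  | cons z w ih =>
    intro u y₀ g h
    have h1 := ih u y₀ (g * z) fun u' hu' => h u' (by simp at hu' ⊢; omega)
    have h2 := ih (u ++ [y₀ * E g]) z 1 fun u' hu' => h u' (by simp at hu' ⊢; omega)
    rw [h (u ++ y₀ * E (g * z) :: w) (by simp), sub_self] at h1
    simp only [hE.1, mul_one, List.append_assoc, List.cons_append, List.nil_append] at h1 h2 ⊢
    rw [extendBlock, extendBlock, ← h2, add_mul, sub_eq_zero.1 h1]
    abel

theorem IsCumulantFamily.onList_mul_right (hE : IsCondExp B E) (hκ : IsCumulantFamily B E κ)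
    (u : List M) (y : M) {b : M} (hb : b ∈ B) :
    onList κ (u ++ [y * b]) = onList κ (u ++ [y]) * b := by
  induction hn : u.length using Nat.strong_induction_on generalizing u with
  | _ n ih =>
    subst hn
    cases u with
    | nil =>
      simp only [List.nil_append, hκ.onList_singleton hE, hE.map_mul_right hb]
    | cons x w =>
      have h := extendBlock_mul_right (κ := κ) hE (y := y) hb w [] x 1 fun u' hu' =>
        ih u'.length (by simp at hu' ⊢; omega) u' rfl
      rw [← hκ.moment_list, ← hκ.moment_list, List.prod_append, List.prod_append,
        List.prod_singleton, List.prod_singleton, ← mul_assoc, ← mul_assoc, ← mul_assoc,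
        hE.map_mul_right hb, sub_self, hE.1, mul_one] at h
      exact sub_eq_zero.1 h.symm

end cumulants

/-- The letters of the sequence `x` with indices in `[a, i)`. -/
def segment (x : ℕ → M) (a i : ℕ) : List M :=
  (List.range' a (i - a)).map x

omit [Ring M] [Algebra ℂ M] in
theorem segment_cons (x : ℕ → M) {a i : ℕ} (h : a < i) :
    segment x a i = x a :: segment x (a + 1) i := by
  obtain ⟨c, rfl⟩ : ∃ c, i = a + c + 1 := ⟨i - a - 1, by omega⟩
  simp only [segment, show a + c + 1 - a = c + 1 by omega,
    show a + c + 1 - (a + 1) = c by omega, List.range'_succ, List.map_cons]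

omit [Ring M] [Algebra ℂ M] in
theorem segment_self (x : ℕ → M) (a : ℕ) : segment x a a = [] := by
  simp [segment]

omit [Ring M] [Algebra ℂ M] in
theorem segment_succ (x : ℕ → M) {a i : ℕ} (h : a ≤ i) :
    segment x a (i + 1) = segment x a i ++ [x i] := by
  obtain ⟨c, rfl⟩ : ∃ c, i = a + c := ⟨i - a, by omega⟩
  simp only [segment, show a + c + 1 - a = c + 1 by omega, show a + c - a = c by omega,
    List.range'_concat, List.map_append, List.map_cons, List.map_nil, Nat.one_mul]

/-- The Wick product of the letters `x a, …, x (k - 1)` with respect to an array `K` of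
coefficients: the sum over all partitions of `[a, k)` into intervals, where an interval `[i, j)`
contributes `- K i j`, and a singleton `i` contributes `x i - K i (i + 1)`. -/
def wick (x : ℕ → M) (K : ℕ → ℕ → M) (a k : ℕ) : M :=
  if a < k then
    x a * wick x K (a + 1) k - ∑ i ∈ (Finset.Ioc a k).attach, K a i * wick x K i k
  else 1
termination_by k - a
decreasing_by
  · omega
  · have := Finset.mem_Ioc.1 i.2
    omega

omit [Algebra ℂ M] in
theorem wick_self (x : ℕ → M) (K : ℕ → ℕ → M) (k : ℕ) : wick x K k k = 1 := by
  rw [wick, if_neg (lt_irrefl k)]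

omit [Algebra ℂ M] in
theorem wick_of_lt (x : ℕ → M) (K : ℕ → ℕ → M) {a k : ℕ} (h : a < k) :
    wick x K a k = x a * wick x K (a + 1) k - ∑ i ∈ Finset.Ioc a k, K a i * wick x K i k := by
  rw [wick, if_pos h, Finset.sum_attach (Finset.Ioc a k) fun i => K a i * wick x K i k]

section wickMean

variable {B : Subalgebra ℂ M} {E : M →ₗ[ℂ] M}
  {κ : ∀ n : ℕ, MultilinearMap ℂ (fun _ : Fin n => M) M}

/-- The block with entries `u`, `y`, followed (after a gap of product `m`) by all of the letters
of `x` with indices in `[j, k)`. -/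
def closeBlock (E : M →ₗ[ℂ] M) (κ : ∀ n : ℕ, MultilinearMap ℂ (fun _ : Fin n => M) M)
    (x : ℕ → M) (k : ℕ) (u : List M) (y : M) (j : ℕ) : M →ₗ[ℂ] M :=
  if j < k then onListLin κ u (segment x j k) ∘ₗ LinearMap.mulLeft ℂ y ∘ₗ E
  else LinearMap.mulLeft ℂ (onList κ (u ++ [y])) ∘ₗ E

theorem closeBlock_of_lt (x : ℕ → M) {k j : ℕ} (h : j < k) (u : List M) (y m : M) :
    closeBlock E κ x k u y j m = onList κ (u ++ y * E m :: segment x j k) := by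
  simp [closeBlock, h, onListLin_apply]

theorem closeBlock_self (x : ℕ → M) (k : ℕ) (u : List M) (y m : M) :
    closeBlock E κ x k u y k m = onList κ (u ++ [y]) * E m := by
  simp [closeBlock]

theorem closeBlock_mul (hE : IsCondExp B E) (hκ : IsCumulantFamily B E κ) (x : ℕ → M) {k j : ℕ}
    (h : j ≤ k) (u : List M) (y m : M) {b : M} (hb : b ∈ B) :
    closeBlock E κ x k u (y * b) j m = closeBlock E κ x k u y j (b * m) := by
  rcases h.lt_or_eq with h | rfl
  · rw [closeBlock_of_lt x h, closeBlock_of_lt x h, hE.map_mul_left hb, mul_assoc]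
  · rw [closeBlock_self, closeBlock_self, hE.map_mul_left hb, hκ.onList_mul_right hE _ _ hb,
      mul_assoc]

theorem closeBlock_append (hE : IsCondExp B E) (x : ℕ → M) {k a : ℕ}
    (h : a < k) (u : List M) (y g : M) :
    closeBlock E κ x k (u ++ [y * E g]) (x a) (a + 1) 1 = closeBlock E κ x k u y a g := by
  rw [closeBlock_of_lt x h, segment_cons x h]
  rcases Nat.lt_or_eq_of_le (Nat.succ_le_of_lt h) with h' | h'
  · rw [closeBlock_of_lt x h', hE.1, mul_one, List.append_assoc, List.singleton_append]
  · rw [Nat.succ_eq_add_one] at h'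
    subst h'
    rw [closeBlock_self, hE.1, mul_one, segment_self, List.append_assoc, List.singleton_append]

/-- The contribution of all ways to continue a block (with entries `u`, `y`, and with `g` the
product of the letters skipped) along the Wick product of the letters in `[a, k)`. -/
def wickBlock (E : M →ₗ[ℂ] M) (κ : ∀ n : ℕ, MultilinearMap ℂ (fun _ : Fin n => M) M)
    (x : ℕ → M) (K : ℕ → ℕ → M) (k a : ℕ) (u : List M) (y g : M) : M :=
  ∑ j ∈ Finset.Icc a k, closeBlock E κ x k u y j (g * wick x K a j)

theorem wickBlock_mul (hE : IsCondExp B E) (hκ : IsCumulantFamily B E κ) (x : ℕ → M)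
    (K : ℕ → ℕ → M) (k a : ℕ) (u : List M) (y g : M) {b : M} (hb : b ∈ B) :
    wickBlock E κ x K k a u (y * b) g = wickBlock E κ x K k a u y (b * g) := by
  refine Finset.sum_congr rfl fun j hj => ?_
  rw [closeBlock_mul hE hκ x (Finset.mem_Icc.1 hj).2 _ _ _ hb, mul_assoc]

theorem closeBlock_eq_zero (x : ℕ → M) {k j : ℕ} (u : List M) (y : M) {m : M}
    (hm : E m = 0) : closeBlock E κ x k u y j m = 0 := by
  unfold closeBlock
  split_ifs <;> simp [hm]

theorem wickBlock_one (x : ℕ → M) (K : ℕ → ℕ → M) {k a : ℕ} (hak : a ≤ k)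
    (h0 : ∀ j, a < j → j ≤ k → E (wick x K a j) = 0) (u : List M) (y : M) :
    wickBlock E κ x K k a u y 1 = closeBlock E κ x k u y a 1 := by
  rw [wickBlock, Finset.sum_eq_single a]
  · rw [wick_self, mul_one]
  · intro j hj hja
    rw [Finset.mem_Icc] at hj
    rw [one_mul, closeBlock_eq_zero x _ _ (h0 j (by omega) hj.2)]
  · intro h
    exact absurd (Finset.left_mem_Icc.2 hak) h

theorem wickBlock_of_lt (hE : IsCondExp B E) (x : ℕ → M) (K : ℕ → ℕ → M) {k a : ℕ} (hak : a < k)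
    (h0 : ∀ j, a + 1 < j → j ≤ k → E (wick x K (a + 1) j) = 0) (u : List M) (y g : M) :
    wickBlock E κ x K k a u y g =
      (wickBlock E κ x K k (a + 1) u y (g * x a) +
        wickBlock E κ x K k (a + 1) (u ++ [y * E g]) (x a) 1) -
      ∑ i ∈ Finset.Ioc a k, wickBlock E κ x K k i u y (g * K a i) := by
  rw [wickBlock_one x K hak h0, closeBlock_append hE x hak]
  have hswap : ∑ i ∈ Finset.Ioc a k, wickBlock E κ x K k i u y (g * K a i) =
      ∑ j ∈ Finset.Ioc a k, ∑ i ∈ Finset.Ioc a j,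
        closeBlock E κ x k u y j (g * K a i * wick x K i j) := by
    refine Finset.sum_comm' fun i j => ?_
    simp only [Finset.mem_Ioc, Finset.mem_Icc]
    omega
  rw [hswap, wickBlock, wickBlock, ← Finset.add_sum_Ioc_eq_sum_Icc hak.le, wick_self, mul_one,
    ← Finset.Icc_add_one_left_eq_Ioc, add_comm, add_sub_right_comm, ← Finset.sum_sub_distrib]
  congr 1
  refine Finset.sum_congr rfl fun j hj => ?_
  rw [Finset.mem_Icc] at hj
  rw [wick_of_lt x K (by omega : a < j), mul_sub, map_sub, Finset.mul_sum, map_sum]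
  simp only [mul_assoc]

theorem mean_mul_wick (hE : IsCondExp B E) (hκ : IsCumulantFamily B E κ) (x : ℕ → M)
    (K : ℕ → ℕ → M) (k a₀ : ℕ) (hK : ∀ a i, K a i ∈ B)
    (h0 : ∀ a j, a₀ < a → a < j → j ≤ k → E (wick x K a j) = 0) :
    ∀ m a, k - a = m → a₀ ≤ a → a ≤ k → ∀ (y : M) (p : List M),
      E (y * p.prod * wick x K a k) = extendBlock E (wickBlock E κ x K k a) [] y 1 p := by
  intro m
  induction m using Nat.strong_induction_on with
  | _ m ih =>
  intro a hm ha hak y p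
  rcases hak.lt_or_eq with hak | rfl
  · have hb : ∀ i ∈ Finset.Ioc a k, E (y * p.prod * (K a i * wick x K i k)) =
        extendBlock E (fun u y g => wickBlock E κ x K k i u y (g * K a i)) [] y 1 p := by
      intro i hi
      rw [Finset.mem_Ioc] at hi
      have ih' := ih (k - i) (by omega) i rfl (by omega) hi.2
      rcases List.eq_nil_or_concat p with rfl | ⟨p, q, rfl⟩
      · have := ih' (y * K a i) []
        simpa [extendBlock, wickBlock_mul hE hκ x K k i _ _ _ (hK a i), mul_assoc] using this
      · have := ih' y (p ++ [q * K a i])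
        rw [extendBlock_append_singleton] at this
        simp only [wickBlock_mul hE hκ x K k i _ _ _ (hK a i)] at this
        rw [List.concat_eq_append, extendBlock_append_singleton]
        simpa [mul_assoc] using this
    have h1 := ih (k - (a + 1)) (by omega) (a + 1) rfl (by omega) hak y (p ++ [x a])
    rw [extendBlock_append_singleton] at h1
    have h2 : wickBlock E κ x K k a = fun u y g =>
        (wickBlock E κ x K k (a + 1) u y (g * x a) +
          wickBlock E κ x K k (a + 1) (u ++ [y * E g]) (x a) 1) -
        ∑ i ∈ Finset.Ioc a k, wickBlock E κ x K k i u y (g * K a i) := by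
      funext u y g
      exact wickBlock_of_lt hE x K hak (h0 (a + 1) · (by omega)) u y g
    rw [h2, extendBlock_sub_sum, ← h1, wick_of_lt x K hak, mul_sub, map_sub, Finset.mul_sum,
      map_sum, Finset.sum_congr rfl hb]
    simp [mul_assoc]
  · have h2 : wickBlock E κ x K a a = fun u y g => onList κ (u ++ [y]) * E g := by
      funext u y g
      simp [wickBlock, wick_self, closeBlock_self]
    rw [wick_self, mul_one, h2, hκ.moment_list]

theorem mean_wick_eq_zero (hE : IsCondExp B E) (hκ : IsCumulantFamily B E κ) (x : ℕ → M)
    (K : ℕ → ℕ → M) (k₀ : ℕ) (hKB : ∀ a i, K a i ∈ B)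
    (hK : ∀ a i, a < i → i ≤ k₀ → K a i = onList κ (segment x a i)) :
    ∀ a k, a < k → k ≤ k₀ → E (wick x K a k) = 0 := by
  intro a k
  induction hm : k - a using Nat.strong_induction_on generalizing a k with
  | _ m ih =>
  intro hak hk
  have h0 : ∀ b j, a < b → b < j → j ≤ k → E (wick x K b j) = 0 := fun b j hb hbj hj =>
    ih (j - b) (by omega) b j rfl hbj (by omega)
  have h1 := mean_mul_wick hE hκ x K k a hKB h0 _ (a + 1) rfl (by omega) hak (x a) []
  have h2 := closeBlock_append (κ := κ) hE x hak [] 0 0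
  rw [List.prod_nil, mul_one, extendBlock, wickBlock_one x K hak (h0 (a + 1) · (by omega))] at h1
  have h3 : closeBlock E κ x k [] (x a) (a + 1) 1 = onList κ (segment x a k) := by
    rw [segment_cons x hak]
    rcases Nat.lt_or_eq_of_le (Nat.succ_le_of_lt hak) with h' | h'
    · rw [closeBlock_of_lt x h', hE.1, mul_one, List.nil_append]
    · rw [Nat.succ_eq_add_one] at h'
      subst h'
      rw [closeBlock_self, hE.1, mul_one, segment_self, List.nil_append]
  rw [wick_of_lt x K hak, map_sub, h1, h3, map_sum, Finset.sum_eq_single k]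
  · rw [wick_self, mul_one, hE.map_eq_self (hKB a k), hK a k hak hk, sub_self]
  · intro i hi hik
    rw [Finset.mem_Ioc] at hi
    rw [hE.map_mul_left (hKB a i), h0 i k hi.1 (by omega) le_rfl, mul_zero]
  · intro h
    exact absurd (Finset.mem_Ioc.2 ⟨hak, le_rfl⟩) h

end wickMean

section compressedWick

/-- The coefficient that precedes the letters `[i, k)` inside a word ending at `k`. -/
def leadingCoeff (b : ℕ → M) (i k : ℕ) : M :=
  if i < k then b (i - 1) else 1

/-- The Wick product of the word `n a * b a, …, n (k - 2) * b (k - 2), n (k - 1)`, with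
respect to the array of coefficients `r` (the interval `[i, j)` contributes
`- r i j * b (j - 1)`, except that the last `b` is omitted). -/
def wickWord (n b : ℕ → M) (r : ℕ → ℕ → M) (a k : ℕ) : M :=
  wick (fun i => if i + 1 = k then n i else n i * b i)
    (fun a i => if i = k then r a i else r a i * b (i - 1)) a k

omit [Algebra ℂ M] in
theorem wickWord_self (n b : ℕ → M) (r : ℕ → ℕ → M) (k : ℕ) : wickWord n b r k k = 1 :=
  wick_self _ _ _

omit [Algebra ℂ M] in
theorem wickWord_of_lt (n b : ℕ → M) (r : ℕ → ℕ → M) {a k : ℕ} (h : a < k) :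
    wickWord n b r a k = n a * (leadingCoeff b (a + 1) k * wickWord n b r (a + 1) k) -
      ∑ i ∈ Finset.Ioc a k, r a i * (leadingCoeff b i k * wickWord n b r i k) := by
  rw [wickWord, wick_of_lt _ _ h]
  congr 1
  · by_cases h' : a + 1 = k
    · simp [leadingCoeff, h', wickWord]
    · simp [leadingCoeff, h', wickWord, show a + 1 < k by omega, mul_assoc]
  · refine Finset.sum_congr rfl fun i hi => ?_
    rw [Finset.mem_Ioc] at hi
    by_cases h' : i = k
    · simp [leadingCoeff, h', wickWord]
    · simp [leadingCoeff, h', wickWord, show i < k by omega, mul_assoc]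

omit [Algebra ℂ M] in
theorem wickWord_congr (n b : ℕ → M) {r r' : ℕ → ℕ → M} {a k : ℕ} (hak : a ≤ k)
    (h : ∀ a' i, a ≤ a' → a' < i → i ≤ k → r a' i = r' a' i) :
    wickWord n b r a k = wickWord n b r' a k := by
  induction hm : k - a using Nat.strong_induction_on generalizing a with
  | _ m ih =>
  rcases hak.lt_or_eq with hak | rfl
  · have ih' : ∀ i, a < i → i ≤ k → wickWord n b r i k = wickWord n b r' i k := fun i hi hik =>
      ih (k - i) (by omega) hik (fun a' j ha' hj hjk => h a' j (by omega) hj hjk) rfl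
    rw [wickWord_of_lt n b r hak, wickWord_of_lt n b r' hak, ih' (a + 1) (by omega) hak]
    congr 1
    refine Finset.sum_congr rfl fun i hi => ?_
    rw [Finset.mem_Ioc] at hi
    rw [ih' i hi.1 hi.2, h a i le_rfl hi.1 hi.2]
  · rw [wickWord_self, wickWord_self]

theorem wickWord_mem (N : Subalgebra ℂ M) {n b : ℕ → M} {r : ℕ → ℕ → M} (hn : ∀ i, n i ∈ N)
    (hb : ∀ i, b i ∈ N) (hr : ∀ a i, r a i ∈ N) {a k : ℕ} (hak : a ≤ k) :
    wickWord n b r a k ∈ N := by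
  induction hm : k - a using Nat.strong_induction_on generalizing a with
  | _ m ih =>
  have hc : ∀ i, leadingCoeff b i k ∈ N := by
    intro i
    unfold leadingCoeff
    split_ifs
    exacts [hb _, N.one_mem]
  rcases hak.lt_or_eq with hak | rfl
  · rw [wickWord_of_lt n b r hak]
    refine N.sub_mem (N.mul_mem (hn a) (N.mul_mem (hc _) (ih _ (by omega) hak rfl)))
      (N.sum_mem fun i hi => ?_)
    rw [Finset.mem_Ioc] at hi
    exact N.mul_mem (hr a i) (N.mul_mem (hc i) (ih _ (by omega) hi.2 rfl))
  · rw [wickWord_self]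
    exact N.one_mem

omit [Algebra ℂ M] in
/-- Expansion of a Wick product in terms of the positions at which, in the decomposition
`b = c + e`, the summand `e` is chosen; the positions are collected from the left. -/
theorem wickWord_add (n c e : ℕ → M) (r : ℕ → ℕ → M) {a k : ℕ} (hak : a < k) :
    wickWord n (c + e) r a k = wickWord n c r a k +
      ∑ j ∈ Finset.Ioo a k,
        wickWord n c r a j * (e (j - 1) * wickWord n (c + e) r j k) := by
  induction hm : k - a using Nat.strong_induction_on generalizing a with
  | _ m ih =>
  have hhat : ∀ i, a < i → i ≤ k → leadingCoeff (c + e) i k * wickWord n (c + e) r i k =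
      leadingCoeff c i k * wickWord n c r i k + ∑ j ∈ Finset.Ico i k,
        leadingCoeff c i j * wickWord n c r i j * (e (j - 1) * wickWord n (c + e) r j k) := by
    intro i hi hik
    rcases hik.lt_or_eq with hik | rfl
    · have hj : ∀ j ∈ Finset.Ioo i k, leadingCoeff c i j * wickWord n c r i j *
            (e (j - 1) * wickWord n (c + e) r j k) = c (i - 1) * (wickWord n c r i j *
            (e (j - 1) * wickWord n (c + e) r j k)) := by
        intro j hj
        rw [leadingCoeff, if_pos (Finset.mem_Ioo.1 hj).1, mul_assoc]
      rw [← Finset.Ioo_insert_left hik, Finset.sum_insert Finset.left_notMem_Ioo,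
        Finset.sum_congr rfl hj, ← Finset.mul_sum, wickWord_self]
      simp only [leadingCoeff, if_pos hik, lt_irrefl, if_false, one_mul, Pi.add_apply, add_mul]
      nth_rewrite 1 [ih (k - i) (by omega) hik rfl]
      rw [mul_add]
      abel
    · simp [leadingCoeff, wickWord_self]
  have hsum : ∑ i ∈ Finset.Ioc a k,
        r a i * (leadingCoeff (c + e) i k * wickWord n (c + e) r i k) =
      ∑ i ∈ Finset.Ioc a k, r a i * (leadingCoeff c i k * wickWord n c r i k) +
      ∑ j ∈ Finset.Ioo a k, ∑ i ∈ Finset.Ioc a j, r a i *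
        (leadingCoeff c i j * wickWord n c r i j * (e (j - 1) * wickWord n (c + e) r j k)) := by
    rw [← Finset.sum_comm' (s := Finset.Ioc a k) (t := fun i => Finset.Ico i k),
      ← Finset.sum_add_distrib]
    · refine Finset.sum_congr rfl fun i hi => ?_
      rw [Finset.mem_Ioc] at hi
      rw [hhat i hi.1 hi.2, mul_add, Finset.mul_sum]
    · intro i j
      simp only [Finset.mem_Ioc, Finset.mem_Ico, Finset.mem_Ioo]
      omega
  rw [wickWord_of_lt n (c + e) r hak, hsum, hhat (a + 1) (by omega) hak, wickWord_of_lt n c r hak,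
    mul_add, Finset.mul_sum, Finset.Ico_add_one_left_eq_Ioo, add_sub_add_comm,
    ← Finset.sum_sub_distrib]
  congr 1
  refine Finset.sum_congr rfl fun j hj => ?_
  rw [wickWord_of_lt n c r (Finset.mem_Ioo.1 hj).1, sub_mul, Finset.sum_mul]
  simp only [mul_assoc]

omit [Algebra ℂ M] in
theorem wickWord_zero_eq_prod (n b : ℕ → M) (l : List (M × M)) : ∀ a : ℕ,
    (∀ i (h : i < l.length), n (a + i) = l[i].1 ∧ b (a + i) = l[i].2) →
    wickWord n b 0 a (a + l.length + 1) =
      (l.map fun p => p.1 * p.2).prod * n (a + l.length) := by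
  induction l with
  | nil =>
    intro a _
    rw [wickWord_of_lt n b 0 (by simp)]
    simp [leadingCoeff, wickWord_self]
  | cons p l ih =>
    intro a h
    have h0 := h 0 (by simp)
    have h1 := ih (a + 1) fun i hi => by
      have := h (i + 1) (by simpa using hi)
      simpa [add_assoc, add_comm 1 i] using this
    rw [show a + 1 + l.length = a + (p :: l).length by simp; omega] at h1
    rw [wickWord_of_lt n b 0 (by omega), h1]
    simp at h0
    simp [leadingCoeff, h0, mul_assoc]

end compressedWick

section wordCumulant

variable {B : Subalgebra ℂ M} {E : M →ₗ[ℂ] M}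
  {κ : ∀ n : ℕ, MultilinearMap ℂ (fun _ : Fin n => M) M}

omit [Ring M] [Algebra ℂ M] in
theorem segment_congr {x y : ℕ → M} {a i : ℕ} (h : ∀ j, a ≤ j → j < i → x j = y j) :
    segment x a i = segment y a i := by
  refine List.map_congr_left fun j hj => ?_
  rw [List.mem_range'_1] at hj
  exact h j hj.1 (by omega)

/-- The cumulant of the word `n a * b a, …, n (i - 2) * b (i - 2), n (i - 1)`. -/
def wordCumulant (κ : ∀ n : ℕ, MultilinearMap ℂ (fun _ : Fin n => M) M) (n b : ℕ → M)
    (a i : ℕ) : M :=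
  onList κ (segment (fun j => n j * b j) a (i - 1) ++ [n (i - 1)])

theorem wordCumulant_shift (n b : ℕ → M) {a i : ℕ} (h : a < i) :
    wordCumulant κ n b a i =
      wordCumulant κ (fun j => n (a + j)) (fun j => b (a + j)) 0 (i - a - 1 + 1) := by
  simp only [wordCumulant, segment, show a + (i - a - 1 + 1 - 1) = i - 1 by omega,
    List.range'_eq_map_range, List.map_map, show i - 1 - a = i - a - 1 + 1 - 1 - 0 by omega]
  congr 3
  funext j
  simp

theorem wordCumulant_eq_apply {k : ℕ} {x : Fin (k + 1) → M} {y : Fin k → M} {n b : ℕ → M}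
    (hx : ∀ j : Fin (k + 1), n j = x j) (hy : ∀ j : Fin k, b j = y j) :
    wordCumulant κ n b 0 (k + 1) =
      κ (k + 1) fun j => if h : (j : ℕ) < k then x j * y ⟨(j : ℕ), h⟩ else x j := by
  refine onList_eq κ (by simp [segment]) fun i => ?_
  by_cases h : (i : ℕ) < k
  · rw [List.getElem_append_left (by simpa [segment] using h)]
    simp [segment, h, hx, ← hy]
  · have h' : (i : ℕ) = k := by omega
    rw [List.getElem_append_right (by simpa [segment] using h'.ge)]
    simp [← hx, h']

theorem wordCumulant_one (hE : IsCondExp B E) (hκ : IsCumulantFamily B E κ) (n b : ℕ → M)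
    (a : ℕ) : wordCumulant κ n b a (a + 1) = E (n a) := by
  simp [wordCumulant, segment_self, hκ.onList_singleton hE]

theorem mean_wickWord_eq_zero (hE : IsCondExp B E) (hκ : IsCumulantFamily B E κ) (n : ℕ → M)
    {b : ℕ → M} (hb : ∀ i, b i ∈ B) {a k : ℕ} (hak : a < k) :
    E (wickWord n b (wordCumulant κ n b) a k) = 0 := by
  refine mean_wick_eq_zero hE hκ _ _ k ?_ ?_ a k hak le_rfl
  · intro a i
    split_ifs
    exacts [hκ.onList_mem _, B.mul_mem (hκ.onList_mem _) (hb _)]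
  · intro a i hai hik
    obtain ⟨i, rfl⟩ : ∃ i', i = i' + 1 := ⟨i - 1, by omega⟩
    have hs : segment (fun j => if j + 1 = k then n j else n j * b j) a i =
        segment (fun j => n j * b j) a i :=
      segment_congr fun j _ hj => if_neg (by omega)
    rw [segment_succ _ (by omega : a ≤ i), hs]
    by_cases h : i + 1 = k
    · subst h
      simp [wordCumulant]
    · simp [h, wordCumulant, ← hκ.onList_mul_right hE _ _ (hb i)]

/-- Vanishing means of Wick products determine the cumulants. -/
theorem wordCumulant_eq_of_mean_eq_zero (hE : IsCondExp B E) (hκ : IsCumulantFamily B E κ)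
    (n : ℕ → M) {b : ℕ → M} (hb : ∀ i, b i ∈ B) {r : ℕ → ℕ → M} (hr : ∀ a i, r a i ∈ B)
    (h0 : ∀ a k, a < k → E (wickWord n b r a k) = 0) {a k : ℕ} (hak : a < k) :
    wordCumulant κ n b a k = r a k := by
  induction hm : k - a using Nat.strong_induction_on generalizing a k with
  | _ m ih =>
  have h1 := h0 a k hak
  have h2 := mean_wickWord_eq_zero hE hκ n hb hak
  have hW : ∀ i, a < i → i ≤ k →
      wickWord n b (wordCumulant κ n b) i k = wickWord n b r i k := fun i hi hik =>
    wickWord_congr n b hik fun a' j ha' hj hjk => ih (j - a') (by omega) hj rfl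
  have hs : ∑ i ∈ Finset.Ioo a k, wordCumulant κ n b a i *
        (leadingCoeff b i k * wickWord n b (wordCumulant κ n b) i k) =
      ∑ i ∈ Finset.Ioo a k, r a i * (leadingCoeff b i k * wickWord n b r i k) := by
    refine Finset.sum_congr rfl fun i hi => ?_
    rw [Finset.mem_Ioo] at hi
    rw [hW i hi.1 hi.2.le, ih (i - a) (by omega) hi.1 rfl]
  rw [wickWord_of_lt _ _ _ hak, ← Finset.Ioo_insert_right hak,
    Finset.sum_insert Finset.right_notMem_Ioo, wickWord_self] at h1 h2
  rw [hs, hW (a + 1) (by omega) hak] at h2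
  have hw : E (wordCumulant κ n b a k) = wordCumulant κ n b a k :=
    hE.map_eq_self (hκ.onList_mem _)
  simp only [leadingCoeff, lt_irrefl, if_false, mul_one, map_sub, map_add,
    hE.map_eq_self (hr a k), hw] at h1 h2
  have h3 := sub_eq_zero.1 h1
  have h4 := sub_eq_zero.1 h2
  rw [h3] at h4
  exact (add_right_cancel h4).symm

end wordCumulant

theorem IsCondExp.comp {B D : Subalgebra ℂ M} {E F : M →ₗ[ℂ] M} (hDB : D ≤ B)
    (hE : IsCondExp B E) (hF1 : F 1 = 1) (hFD : ∀ b ∈ B, F b ∈ D)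
    (hFbimod : ∀ d ∈ D, ∀ d' ∈ D, ∀ b ∈ B, F (d * b * d') = d * F b * d') :
    IsCondExp D (F ∘ₗ E) := by
  refine ⟨by simp [hE.1, hF1], fun x => hFD _ (hE.2.1 x), fun d hd d' hd' x => ?_⟩
  rw [LinearMap.comp_apply, hE.2.2 d (hDB hd) d' (hDB hd'), hFbimod d hd d' hd' _ (hE.2.1 x),
    LinearMap.comp_apply]

section freeness

/-- The list consists of `G`-centered elements taken alternately from `S₁` and `S₂`; it starts
in `S₁` if the flag is `true` and in `S₂` otherwise. -/
def IsAlternating (G : M →ₗ[ℂ] M) (S₁ S₂ : Set M) : Bool → List M → Prop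
  | _, [] => True
  | f, a :: L => a ∈ (if f then S₁ else S₂) ∧ G a = 0 ∧ IsAlternating G S₁ S₂ (!f) L

variable {G : M →ₗ[ℂ] M} {S₁ S₂ : Set M}

theorem IsAlternating.getElem {L : List M} {f : Bool} (h : IsAlternating G S₁ S₂ f L) {j : ℕ}
    (hj : j < L.length) : L[j] ∈ (if not^[j] f then S₁ else S₂) ∧ G L[j] = 0 := by
  induction L generalizing f j with
  | nil => simp at hj
  | cons a L ih =>
    cases j with
    | zero => exact ⟨h.1, h.2.1⟩
    | succ j => exact ih h.2.2 (by simpa using hj)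

theorem isAlternating_ofFn {k : ℕ} {a : Fin (k + 1) → M} {f : Fin (k + 1) → Bool}
    (ha : ∀ j, a j ∈ (if f j then S₁ else S₂)) (h0 : ∀ j, G (a j) = 0)
    (hf : ∀ (j : ℕ) (h : j + 1 < k + 1), f ⟨j, Nat.lt_of_succ_lt h⟩ ≠ f ⟨j + 1, h⟩) :
    IsAlternating G S₁ S₂ (f 0) (List.ofFn a) := by
  induction k with
  | zero => exact ⟨ha 0, h0 0, by simp [IsAlternating]⟩
  | succ k ih =>
    rw [List.ofFn_succ]
    refine ⟨ha 0, h0 0, ?_⟩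
    have h1 : (!f 0) = f (Fin.succ 0) := by
      have : f 0 ≠ f (Fin.succ 0) := hf 0 (by omega)
      revert this
      cases f 0 <;> cases f (Fin.succ 0) <;> simp
    rw [h1]
    exact ih (a := fun j => a j.succ) (f := fun j => f j.succ) (fun j => ha j.succ)
      (fun j => h0 j.succ) fun j hj => hf (j + 1) (by omega)

theorem isFreeWithAmalgamation_iff : IsFreeWithAmalgamation G S₁ S₂ ↔
    ∀ f L, L ≠ [] → IsAlternating G S₁ S₂ f L → G L.prod = 0 := by
  constructor
  · intro h f L hL hA
    have := h L.length (List.length_pos_of_ne_nil hL) L.get (fun j => not^[(j : ℕ)] f)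
      (fun j => (hA.getElem j.2).1) (fun j => (hA.getElem j.2).2) fun j hj => by
        simp [Function.iterate_succ_apply']
    simpa using this
  · intro h k hk a f ha h0 hf
    obtain ⟨k, rfl⟩ : ∃ m, k = m + 1 := ⟨k - 1, by omega⟩
    exact h _ _ (by simp) (isAlternating_ofFn ha h0 hf)

end freeness

section centeredWords

variable {B D N : Subalgebra ℂ M} {E F : M →ₗ[ℂ] M}

/-- The pairs `p` with both components centered and `p.1 ∈ N`, `p.2 ∈ B`. -/
def IsCenteredPair (B N : Subalgebra ℂ M) (E F : M →ₗ[ℂ] M) (p : M × M) : Prop :=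
  (p.1 ∈ N ∧ F (E p.1) = 0) ∧ p.2 ∈ B ∧ F p.2 = 0

/-- `E` annihilates the alternating centered words that start and end in `N`. -/
def CenteredWordsVanish (B N : Subalgebra ℂ M) (E F : M →ₗ[ℂ] M) : Prop :=
  ∀ (l : List (M × M)) (y : M), (∀ p ∈ l, IsCenteredPair B N E F p) → y ∈ N → F (E y) = 0 →
    E ((l.map fun p => p.1 * p.2).prod * y) = 0

theorem isAlternating_of_centeredPairs (hE : IsCondExp B E) {l : List (M × M)}
    (hl : ∀ p ∈ l, IsCenteredPair B N E F p) {t : List M}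
    (ht : IsAlternating (F ∘ₗ E) N B true t) :
    IsAlternating (F ∘ₗ E) N B true (l.flatMap (fun p => [p.1, p.2]) ++ t) := by
  induction l with
  | nil => exact ht
  | cons p l ih =>
    have hp := hl p (by simp)
    refine ⟨hp.1.1, hp.1.2, hp.2.1, ?_, ih fun q hq => hl q (by simp [hq])⟩
    rw [LinearMap.comp_apply, hE.map_eq_self hp.2.1, hp.2.2]

omit [Algebra ℂ M] in
theorem prod_flatMap_pair (l : List (M × M)) :
    (l.flatMap fun p => [p.1, p.2]).prod = (l.map fun p => p.1 * p.2).prod := by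
  induction l with
  | nil => rfl
  | cons p l ih => simp [ih, mul_assoc]

theorem centeredWordsVanish_of_isFree (hDB : D ≤ B) (hE : IsCondExp B E)
    (hG : IsCondExp D (F ∘ₗ E))
    (hFfaithful : ∀ b₁ ∈ B, (∀ b₂ ∈ B, F (b₁ * b₂) = 0) → b₁ = 0)
    (h : IsFreeWithAmalgamation (F ∘ₗ E) (N : Set M) (B : Set M)) :
    CenteredWordsVanish B N E F := by
  rw [isFreeWithAmalgamation_iff] at h
  intro l y hl hy hy0
  set w := (l.map fun p => p.1 * p.2).prod * y with hw
  refine hFfaithful _ (hE.2.1 _) fun b hb => ?_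
  have hFb : F b ∈ D := by simpa [hE.map_eq_self hb] using hG.2.1 b
  have hG1 : F (E w) = 0 := by
    have := h true _ (by simp) (isAlternating_of_centeredPairs hE hl (t := [y])
      ⟨hy, hy0, trivial⟩)
    simpa [prod_flatMap_pair, hw] using this
  have hFF : F (E (F b)) = F b := hG.map_eq_self hFb
  have hG2 : F (E (w * (b - F b))) = 0 := by
    have := h true _ (by simp) (isAlternating_of_centeredPairs hE hl (t := [y, b - F b])
      ⟨hy, hy0, B.sub_mem hb (hDB hFb), by simp [hE.map_eq_self hb, hFF], trivial⟩)
    simpa [prod_flatMap_pair, hw, mul_assoc] using this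
  have hG3 : F (E (w * F b)) = F (E w) * F b := hG.map_mul_right hFb w
  rw [← hE.map_mul_right hb, ← sub_add_cancel b (F b), mul_add, map_add, map_add, hG2, hG3, hG1]
  simp

theorem isFree_of_centeredWordsVanish (hE : IsCondExp B E) (h : CenteredWordsVanish B N E F) :
    IsFreeWithAmalgamation (F ∘ₗ E) (N : Set M) (B : Set M) := by
  have key : ∀ (m : ℕ) (L : List M), L.length = m → L ≠ [] → IsAlternating (F ∘ₗ E) N B true L →
      ∀ l : List (M × M), (∀ p ∈ l, IsCenteredPair B N E F p) →
        E ((l.map fun p => p.1 * p.2).prod * L.prod) = 0 := by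
    intro m
    induction m using Nat.strong_induction_on with
    | _ m ih =>
    intro L hm hL hA l hl
    match L, hL, hA, hm with
    | [n], _, hA, _ =>
      simpa using h l n hl hA.1 hA.2.1
    | [n, b], _, hA, _ =>
      have hb : b ∈ B := hA.2.2.1
      simp [← mul_assoc, hE.map_mul_right hb, h l n hl hA.1 hA.2.1]
    | n :: b :: c :: L, _, hA, hm =>
      have hb : b ∈ B := hA.2.2.1
      have hb0 : F (E b) = 0 := hA.2.2.2.1
      have hnb : IsCenteredPair B N E F (n, b) :=
        ⟨⟨hA.1, hA.2.1⟩, hb, by rwa [hE.map_eq_self hb] at hb0⟩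
      have := ih (c :: L).length (by simp at hm ⊢; omega) (c :: L) rfl (by simp) hA.2.2.2.2
        (l ++ [(n, b)]) (by simpa [or_imp, forall_and, hnb] using hl)
      simpa [mul_assoc] using this
  rw [isFreeWithAmalgamation_iff]
  intro f L hL hA
  rw [LinearMap.comp_apply]
  cases f with
  | true =>
    have := key _ L rfl hL hA [] (by simp)
    simp at this
    rw [this, map_zero]
  | false =>
    match L, hL, hA with
    | [b], _, hA => simpa using hA.2.1
    | b :: c :: L, _, hA =>
      have hb : b ∈ B := hA.1
      have := key _ (c :: L) rfl (by simp) hA.2.2 [] (by simp)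
      simp only [List.map_nil, List.prod_nil, one_mul] at this
      rw [List.prod_cons, hE.map_mul_left hb, this, mul_zero, map_zero]

end centeredWords

section factorization

variable {B D N : Subalgebra ℂ M} {E F : M →ₗ[ℂ] M}
  {κB κD : ∀ n : ℕ, MultilinearMap ℂ (fun _ : Fin n => M) M}

theorem mean_mul_wickWord_eq_zero (hDN : D ≤ N) (hG : IsCondExp D (F ∘ₗ E))
    (hκD : IsCumulantFamily D (F ∘ₗ E) κD) (h : CenteredWordsVanish B N E F) {n c e : ℕ → M}
    (hn : ∀ i, n i ∈ N) (hc : ∀ i, c i ∈ D) (he : ∀ i, e i ∈ B ∧ F (e i) = 0) {a k : ℕ}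
    (hak : a < k) (l : List (M × M)) (hl : ∀ p ∈ l, IsCenteredPair B N E F p) :
    E ((l.map fun p => p.1 * p.2).prod * wickWord n (c + e) (wordCumulant κD n c) a k) = 0 := by
  induction hm : k - a using Nat.strong_induction_on generalizing a l with
  | _ m ih =>
  have hN : ∀ j, a < j → wickWord n c (wordCumulant κD n c) a j ∈ N ∧
      F (E (wickWord n c (wordCumulant κD n c) a j)) = 0 := fun j hj =>
    ⟨wickWord_mem N hn (fun i => hDN (hc i)) (fun _ _ => hDN (hκD.onList_mem _)) hj.le,
      mean_wickWord_eq_zero hG hκD n hc hj⟩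
  rw [wickWord_add n c e _ hak, mul_add, map_add, h l _ hl (hN k hak).1 (hN k hak).2, zero_add,
    Finset.mul_sum, map_sum]
  refine Finset.sum_eq_zero fun j hj => ?_
  rw [Finset.mem_Ioo] at hj
  have hp : IsCenteredPair B N E F (wickWord n c (wordCumulant κD n c) a j, e (j - 1)) :=
    ⟨hN j hj.1, he _⟩
  have := ih (k - j) (by omega) hj.2
    (l ++ [(wickWord n c (wordCumulant κD n c) a j, e (j - 1))])
    (by simpa [or_imp, forall_and, hp] using hl) rfl
  simpa [mul_assoc] using this

/-- The `B`-valued cumulants of words in `N` and `B` are the `D`-valued cumulants of the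
compressed words. -/
def CumulantsCompress (B N : Subalgebra ℂ M) (F : M →ₗ[ℂ] M)
    (κB κD : ∀ n : ℕ, MultilinearMap ℂ (fun _ : Fin n => M) M) : Prop :=
  ∀ n b : ℕ → M, (∀ i, n i ∈ N) → (∀ i, b i ∈ B) → ∀ a i, a < i →
    wordCumulant κB n b a i = wordCumulant κD n (fun j => F (b j)) a i

/-- The `B`-valued cumulants of words in `N` and `B` factorize through `F`. -/
def CumulantsFactorize (B N : Subalgebra ℂ M) (F : M →ₗ[ℂ] M)
    (κB : ∀ n : ℕ, MultilinearMap ℂ (fun _ : Fin n => M) M) : Prop :=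
  ∀ n b : ℕ → M, (∀ i, n i ∈ N) → (∀ i, b i ∈ B) → ∀ a i, a < i →
    wordCumulant κB n b a i = F (wordCumulant κB n (fun j => F (b j)) a i)

theorem cumulantsCompress_of_centeredWordsVanish (hDB : D ≤ B) (hDN : D ≤ N)
    (hE : IsCondExp B E) (hG : IsCondExp D (F ∘ₗ E)) (hκB : IsCumulantFamily B E κB)
    (hκD : IsCumulantFamily D (F ∘ₗ E) κD) (h : CenteredWordsVanish B N E F) :
    CumulantsCompress B N F κB κD := by
  intro n b hn hb a i hai
  have hFb : ∀ j, F (b j) ∈ D := fun j => by simpa [hE.map_eq_self (hb j)] using hG.2.1 (b j)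
  have hFF : ∀ j, F (F (b j)) = F (b j) := fun j => by
    simpa [hE.map_eq_self (hDB (hFb j))] using hG.map_eq_self (hFb j)
  refine wordCumulant_eq_of_mean_eq_zero hE hκB n hb
    (r := wordCumulant κD n fun j => F (b j)) (fun _ _ => hDB (hκD.onList_mem _)) ?_ hai
  intro a k hak
  have := mean_mul_wickWord_eq_zero hDN hG hκD h hn hFb (e := fun j => b j - F (b j))
    (fun j => ⟨B.sub_mem (hb j) (hDB (hFb j)), by simp [hFF]⟩) hak [] (by simp)
  have hsum : ((fun j => F (b j)) + fun j => b j - F (b j)) = b := by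
    funext j
    simp
  rwa [hsum, List.map_nil, List.prod_nil, one_mul] at this

theorem wordCumulant_eq_zero {n b : ℕ → M} {a i : ℕ} (hai : a + 1 < i) (h : n a * b a = 0) :
    wordCumulant κB n b a i = 0 := by
  rw [wordCumulant, segment_cons _ (by omega), h]
  simpa using (onListLin_apply κB [] (segment (fun j => n j * b j) (a + 1) (i - 1) ++ [n (i - 1)])
    0).symm.trans (map_zero _)

theorem centeredWordsVanish_of_cumulantsCompress (hE : IsCondExp B E)
    (hG : IsCondExp D (F ∘ₗ E)) (hκB : IsCumulantFamily B E κB)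
    (hκD : IsCumulantFamily D (F ∘ₗ E) κD) (h : CumulantsCompress B N F κB κD) :
    CenteredWordsVanish B N E F := by
  intro l y hl hy hy0
  obtain ⟨n, b, hn, hb, hFb, hn0, hnb, hny⟩ : ∃ n b : ℕ → M, (∀ i, n i ∈ N) ∧ (∀ i, b i ∈ B) ∧
      (∀ i, F (b i) = 0) ∧ (∀ i, F (E (n i)) = 0) ∧
      (∀ i (h : i < l.length), n i = l[i].1 ∧ b i = l[i].2) ∧ n l.length = y := by
    refine ⟨fun i => if h : i < l.length then l[i].1 else y,
      fun i => if h : i < l.length then l[i].2 else 0, fun i => ?_, fun i => ?_, fun i => ?_,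
      fun i => ?_, fun i hi => by simp [hi], by simp⟩
    all_goals
      dsimp only
      split_ifs with hi
    · exact (hl _ (List.getElem_mem hi)).1.1
    · exact hy
    · exact (hl _ (List.getElem_mem hi)).2.1
    · exact B.zero_mem
    · exact (hl _ (List.getElem_mem hi)).2.2
    · exact map_zero F
    · exact (hl _ (List.getElem_mem hi)).1.2
    · exact hy0
  have hw := wickWord_zero_eq_prod n b l 0 (by simpa using hnb)
  rw [zero_add, hny] at hw
  rw [← hw, ← wickWord_congr n b (r := wordCumulant κB n b) (Nat.zero_le _)]
  · exact mean_wickWord_eq_zero hE hκB n hb (by omega)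
  · intro a i _ hai _
    rw [h n b hn hb a i hai, Pi.zero_apply, Pi.zero_apply]
    rcases (Nat.succ_le_of_lt hai).lt_or_eq with hai | rfl
    · exact wordCumulant_eq_zero hai (by rw [hFb, mul_zero])
    · exact (wordCumulant_one hG hκD _ _ _).trans (hn0 a)

theorem cumulantsFactorize_of_cumulantsCompress (hDB : D ≤ B) (hE : IsCondExp B E)
    (hG : IsCondExp D (F ∘ₗ E)) (hκD : IsCumulantFamily D (F ∘ₗ E) κD)
    (h : CumulantsCompress B N F κB κD) : CumulantsFactorize B N F κB := by
  have hF : ∀ d ∈ D, F d = d := fun d hd => by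
    simpa [hE.map_eq_self (hDB hd)] using hG.map_eq_self hd
  intro n b hn hb a i hai
  have hFb : ∀ j, F (b j) ∈ D := fun j => by simpa [hE.map_eq_self (hb j)] using hG.2.1 (b j)
  rw [h n b hn hb a i hai, h n _ hn (fun j => hDB (hFb j)) a i hai]
  simp only [hF _ (hFb _)]
  exact (hF _ (hκD.onList_mem _)).symm

theorem cumulantsCompress_of_cumulantsFactorize (hDB : D ≤ B) (hDN : D ≤ N)
    (hE : IsCondExp B E) (hG : IsCondExp D (F ∘ₗ E)) (hκB : IsCumulantFamily B E κB)
    (hκD : IsCumulantFamily D (F ∘ₗ E) κD) (h : CumulantsFactorize B N F κB) :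
    CumulantsCompress B N F κB κD := by
  have hF : ∀ d ∈ D, F d = d := fun d hd => by
    simpa [hE.map_eq_self (hDB hd)] using hG.map_eq_self hd
  have hEN : ∀ x ∈ N, E x = F (E x) := fun x hx => by
    simpa [wordCumulant_one hE hκB] using
      h (fun _ => x) 0 (fun _ => hx) (fun _ => B.zero_mem) 0 1 (by omega)
  intro n b hn hb a i hai
  have hFb : ∀ j, F (b j) ∈ D := fun j => by simpa [hE.map_eq_self (hb j)] using hG.2.1 (b j)
  have hcomp : wordCumulant κB n (fun j => F (b j)) a i =
      wordCumulant κD n (fun j => F (b j)) a i := by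
    refine wordCumulant_eq_of_mean_eq_zero hE hκB n (fun j => hDB (hFb j))
      (r := wordCumulant κD n fun j => F (b j)) (fun _ _ => hDB (hκD.onList_mem _)) (fun a k hak => ?_) hai
    have hmem : wickWord n (fun j => F (b j)) (wordCumulant κD n fun j => F (b j)) a k ∈ N :=
      wickWord_mem N hn (fun i => hDN (hFb i)) (fun _ _ => hDN (hκD.onList_mem _)) hak.le
    rw [hEN _ hmem]
    exact mean_wickWord_eq_zero hG hκD n hFb hak
  rw [h n b hn hb a i hai, hcomp]
  exact hF _ (hκD.onList_mem _)

theorem forall_wordCumulant_iff {κ κ' : ∀ n : ℕ, MultilinearMap ℂ (fun _ : Fin n => M) M} (T : M → M) :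
    (∀ n b : ℕ → M, (∀ i, n i ∈ N) → (∀ i, b i ∈ B) → ∀ a i, a < i →
      wordCumulant κ n b a i = T (wordCumulant κ' n (fun j => F (b j)) a i)) ↔
    ∀ (k : ℕ) (x : Fin (k + 1) → M) (b : Fin k → M), (∀ j, x j ∈ N) → (∀ j, b j ∈ B) →
      κ (k + 1) (fun j => if h : (j : ℕ) < k then x j * b ⟨(j : ℕ), h⟩ else x j) =
        T (κ' (k + 1)
          (fun j => if h : (j : ℕ) < k then x j * F (b ⟨(j : ℕ), h⟩) else x j)) := by
  constructor
  · intro h k x b hx hb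
    have := h (fun i => if hi : i < k + 1 then x ⟨i, hi⟩ else 0)
      (fun i => if hi : i < k then b ⟨i, hi⟩ else 0) (fun i => by
        split_ifs
        exacts [hx _, N.zero_mem]) (fun i => by
        split_ifs
        exacts [hb _, B.zero_mem]) 0 (k + 1) (by omega)
    rwa [wordCumulant_eq_apply (x := x) (y := b) (fun j => dif_pos j.2) (by simp),
      wordCumulant_eq_apply (x := x) (y := fun j => F (b j)) (fun j => dif_pos j.2) (by simp)] at this
  · intro h n b hn hb a i hai
    rw [wordCumulant_shift n b hai, wordCumulant_shift n _ hai,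
      wordCumulant_eq_apply (x := fun j => n (a + j)) (y := fun j => b (a + j))
        (fun _ => rfl) (fun _ => rfl),
      wordCumulant_eq_apply (x := fun j => n (a + j)) (y := fun j => F (b (a + j)))
        (fun _ => rfl) (fun _ => rfl)]
    exact h _ (fun j => n (a + j)) (fun j => b (a + j)) (fun _ => hn _) (fun _ => hb _)

end factorization

theorem subalgebra_freeness_iff_cumulant_factorization
    (B D : Subalgebra ℂ M) (hDB : D ≤ B)
    (E F : M →ₗ[ℂ] M) (hE : IsCondExp B E)
    (hF1 : F 1 = 1) (hFD : ∀ b ∈ B, F b ∈ D)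
    (hFbimod : ∀ d ∈ D, ∀ d' ∈ D, ∀ b ∈ B, F (d * b * d') = d * F b * d')
    (hFfaithful : ∀ b₁ ∈ B, (∀ b₂ ∈ B, F (b₁ * b₂) = 0) → b₁ = 0)
    (κB κD : ∀ n : ℕ, MultilinearMap ℂ (fun _ : Fin n => M) M)
    (hκB : IsCumulantFamily B E κB) (hκD : IsCumulantFamily D (F ∘ₗ E) κD)
    (N : Subalgebra ℂ M) (hDN : D ≤ N) :
    (IsFreeWithAmalgamation (F ∘ₗ E) (N : Set M) (B : Set M) ↔
      ∀ (k : ℕ) (x : Fin (k + 1) → M) (b : Fin k → M),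
        (∀ j, x j ∈ N) → (∀ j, b j ∈ B) →
        κB (k + 1) (fun j => if h : (j : ℕ) < k then x j * b ⟨(j : ℕ), h⟩ else x j) =
          F (κB (k + 1)
            (fun j => if h : (j : ℕ) < k then x j * F (b ⟨(j : ℕ), h⟩) else x j))) ∧
    (IsFreeWithAmalgamation (F ∘ₗ E) (N : Set M) (B : Set M) ↔
      ∀ (k : ℕ) (x : Fin (k + 1) → M) (b : Fin k → M),
        (∀ j, x j ∈ N) → (∀ j, b j ∈ B) →
        κB (k + 1) (fun j => if h : (j : ℕ) < k then x j * b ⟨(j : ℕ), h⟩ else x j) =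
          κD (k + 1)
            (fun j => if h : (j : ℕ) < k then x j * F (b ⟨(j : ℕ), h⟩) else x j)) := by
  have hG : IsCondExp D (F ∘ₗ E) := hE.comp hDB hF1 hFD hFbimod
  have hfree : IsFreeWithAmalgamation (F ∘ₗ E) (N : Set M) (B : Set M) ↔
      CumulantsCompress B N F κB κD :=
    ⟨fun h => cumulantsCompress_of_centeredWordsVanish hDB hDN hE hG hκB hκD
        (centeredWordsVanish_of_isFree hDB hE hG hFfaithful h),
      fun h => isFree_of_centeredWordsVanish hE
        (centeredWordsVanish_of_cumulantsCompress hE hG hκB hκD h)⟩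
  have hfact : CumulantsCompress B N F κB κD ↔ CumulantsFactorize B N F κB :=
    ⟨cumulantsFactorize_of_cumulantsCompress hDB hE hG hκD,
      cumulantsCompress_of_cumulantsFactorize hDB hDN hE hG hκB hκD⟩
  exact ⟨(hfree.trans hfact).trans (forall_wordCumulant_iff F),
    hfree.trans (forall_wordCumulant_iff id)⟩

end OVD
end
end

section
/- Let N ⊂ M be a subalgebra, let D ⊂ C ⊂ B ⊂ M be subalgebras with conditional expectations E_C: M → C, E_B: M → B, E_D: M → D satisfying E_D = E_D∘E_C and E_C = E_C∘E_B. Assume that the restrictions E_C|_B: B → C, E_D|_C: C → D and E_D|_B: B → D each satisfy the faithfulness condition (if b₁ is in the domain and the conditional expectation of b₁b₂ is 0 for all b₂ in the domain, then b₁ = 0). If N is free from C with amalgamation over D and also free from B with amalgamation over C, then N is free from B with amalgamation over D. -/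
/-!  Statement 6 (Proposition 3.7):  if `N` is free from `C` with amalgamation
over `D`, and free from `B` with amalgamation over `C` (where `D ⊆ C ⊆ B`,
with compatible conditional expectations having the stated faithfulness
properties), then `N` is free from `B` with amalgamation over `D`. -/

noncomputable section

namespace OVD

variable {M : Type*} [Ring M] [Algebra ℂ M]

/-- `AlternatingWord S b m` says that `m` is a nonempty product of elements of `S true` and
`S false`, taken alternately, whose last factor lies in `S b`. -/
inductive AlternatingWord (S : Bool → Set M) : Bool → M → Prop
  | single (b : Bool) (x : M) (hx : x ∈ S b) : AlternatingWord S b x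
  | snoc (b : Bool) (m x : M) (hm : AlternatingWord S b m) (hx : x ∈ S (!b)) :
      AlternatingWord S (!b) (m * x)

/-- The elements of `S₁` (for `true`) or `S₂` (for `false`) killed by `E`. -/
def centered (E : M →ₗ[ℂ] M) (S₁ S₂ : Set M) (b : Bool) : Set M :=
  {x | x ∈ (if b then S₁ else S₂) ∧ E x = 0}

theorem AlternatingWord.exists_list {R : Type*} [Ring R] {S : Bool → Set R} {b : Bool} {m : R}
    (h : AlternatingWord S b m) :
    ∃ (x : R) (l : List (Bool × R)), (∀ p ∈ (b, x) :: l, p.2 ∈ S p.1) ∧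
      ((b, x) :: l).IsChain (fun p q => q.1 ≠ p.1) ∧
      (((b, x) :: l).reverse.map Prod.snd).prod = m := by
  induction h with
  | single b x hx => exact ⟨x, [], by simpa using hx, by simp, by simp⟩
  | snoc b m x _ hx ih =>
    obtain ⟨y, l, h₁, h₂, h₃⟩ := ih
    refine ⟨x, (b, y) :: l, ?_, ?_, ?_⟩
    · intro p hp
      rcases List.mem_cons.1 hp with rfl | hp
      · exact hx
      · exact h₁ p hp
    · exact List.isChain_cons_cons.2 ⟨by cases b <;> simp, h₂⟩
    · rw [List.reverse_cons, List.map_append, List.prod_append, h₃]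
      simp

theorem IsFreeWithAmalgamation.map_eq_zero {E : M →ₗ[ℂ] M} {S₁ S₂ : Set M}
    (h : IsFreeWithAmalgamation E S₁ S₂) {b : Bool} {m : M}
    (hm : AlternatingWord (centered E S₁ S₂) b m) : E m = 0 := by
  obtain ⟨x, l, h₁, h₂, rfl⟩ := hm.exists_list
  rw [← List.isChain_reverse] at h₂
  have hpos : 0 < ((b, x) :: l).reverse.length := by simp
  have h₁' : ∀ p ∈ ((b, x) :: l).reverse, p.2 ∈ centered E S₁ S₂ p.1 :=
    fun p hp => h₁ p (List.mem_reverse.1 hp)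
  generalize ((b, x) :: l).reverse = L at *
  have key := h L.length hpos (fun j => (L.get j).2) (fun j => (L.get j).1)
    (fun j => (h₁' _ (L.get_mem j)).1) (fun j => (h₁' _ (L.get_mem j)).2)
    (fun j hj => by simpa using List.isChain_iff_getElem.1 h₂ j hj)
  have hL : List.ofFn (fun j => (L.get j).2) = L.map Prod.snd := by
    rw [← List.ofFn_get L]
    simp
  rwa [hL] at key

/-- The partially processed words ending in the state `b`: alternating words in centered elements
of `N ⊔ D` and `C`, possibly preceded by an alternating word in `E_C`-centered elements of `N ⊔ C`
and `B` that ends in `B`. -/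
inductive ReducedWord (SA SF : Bool → Set M) : Bool → M → Prop
  | inner (b : Bool) (w : M) (hw : AlternatingWord SA b w) : ReducedWord SA SF b w
  | outer (p : M) (hp : AlternatingWord SF false p) : ReducedWord SA SF false p
  | outer_inner (p w : M) (hp : AlternatingWord SF false p) (hw : AlternatingWord SA true w) :
      ReducedWord SA SF true (p * w)
  | outer_inner_snoc (p w c : M) (hp : AlternatingWord SF false p)
      (hw : AlternatingWord SA true w) (hc : c ∈ SA false) : ReducedWord SA SF false (p * (w * c))

theorem IsCondExp.map_mul_right_s6 {B : Subalgebra ℂ M} {E : M →ₗ[ℂ] M} (h : IsCondExp B E)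
    (x : M) {b : M} (hb : b ∈ B) : E (x * b) = E x * b := by
  simpa using h.2.2 1 B.one_mem b hb x

theorem IsCondExp.map_of_mem {B : Subalgebra ℂ M} {E : M →ₗ[ℂ] M} (h : IsCondExp B E)
    {b : M} (hb : b ∈ B) : E b = b := by
  simpa [h.1] using h.map_mul_right_s6 1 hb

theorem AlternatingWord.mem_subalgebra {S : Bool → Set M} {A : Subalgebra ℂ M}
    (hS : ∀ b, S b ⊆ A) {b : Bool} {m : M} (h : AlternatingWord S b m) : m ∈ A := by
  induction h with
  | single b x hx => exact hS b hx
  | snoc b m x _ hx ih => exact A.mul_mem ih (hS _ hx)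

/-- A word that is centered over `D` and ends in the algebra free from `C` over `D` is centered
over `C`. -/
theorem IsFreeWithAmalgamation.map_eq_zero_of_ends_true {D C : Subalgebra ℂ M} {S : Set M}
    (hDC : D ≤ C) {ED EC : M →ₗ[ℂ] M} (hED : IsCondExp D ED) (hEC : IsCondExp C EC)
    (hcomp : ED ∘ₗ EC = ED)
    (hfaith : ∀ c₁ ∈ C, (∀ c₂ ∈ C, ED (c₁ * c₂) = 0) → c₁ = 0)
    (hfree : IsFreeWithAmalgamation ED S (C : Set M)) {w : M}
    (hw : AlternatingWord (centered ED S (C : Set M)) true w) : EC w = 0 := by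
  refine hfaith _ (hEC.2.1 w) fun c hc => ?_
  have hEDc : ED c ∈ D := hED.2.1 c
  have hc₀ : c - ED c ∈ centered ED S (C : Set M) (!true) :=
    ⟨by simpa using C.sub_mem hc (hDC hEDc), by rw [map_sub, hED.map_of_mem hEDc, sub_self]⟩
  have h₁ : ED (w * (c - ED c)) = 0 := hfree.map_eq_zero (hw.snoc _ _ _ hc₀)
  rw [mul_sub, map_sub, hED.map_mul_right_s6 w hEDc, hfree.map_eq_zero hw, zero_mul, sub_zero] at h₁
  rw [← hEC.map_mul_right_s6 w hc]
  exact (LinearMap.congr_fun hcomp (w * c)).trans h₁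

theorem sub_map_mem_centered {C B : Subalgebra ℂ M} {S T : Set M} (hCB : C ≤ B)
    {ED EC : M →ₗ[ℂ] M} (hEC : IsCondExp C EC) (hcomp : ED ∘ₗ EC = ED) {b : M}
    (hb : b ∈ centered ED T (B : Set M) false) :
    b - EC b ∈ centered EC S (B : Set M) false ∧ EC b ∈ centered ED T (C : Set M) false := by
  have hECb : EC b ∈ C := hEC.2.1 b
  refine ⟨⟨?_, ?_⟩, ?_, ?_⟩
  · simpa using B.sub_mem (by simpa using hb.1) (hCB hECb)
  · rw [map_sub, hEC.map_of_mem hECb, sub_self]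
  · simpa using hECb
  · exact (LinearMap.congr_fun hcomp b).trans hb.2

theorem ReducedWord.mul_true {R : Type*} [Ring R] {SA SF : Bool → Set R} {m n : R}
    (h : ReducedWord SA SF false m) (hn : n ∈ SA true) : ReducedWord SA SF true (m * n) := by
  cases h with
  | inner _ _ hw => exact .inner _ _ (hw.snoc false _ _ hn)
  | outer _ hp => exact .outer_inner _ _ hp (.single _ _ hn)
  | outer_inner_snoc p w c hp hw hc =>
    rw [mul_assoc]
    exact .outer_inner _ _ hp ((hw.snoc true _ _ hc).snoc false _ _ hn)

theorem ReducedWord.mul_inner {R : Type*} [Ring R] {SA SF : Bool → Set R} {m c : R}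
    (h : ReducedWord SA SF true m) (hc : c ∈ SA false) : ReducedWord SA SF false (m * c) := by
  cases h with
  | inner _ _ hw => exact .inner _ _ (hw.snoc true _ _ hc)
  | outer_inner p w hp hw =>
    rw [mul_assoc]
    exact .outer_inner_snoc _ _ _ hp hw hc

theorem ReducedWord.mul_outer {R : Type*} [Ring R] {SA SF : Bool → Set R}
    (hAF : ∀ w, AlternatingWord SA true w → w ∈ SF true) {m b : R}
    (h : ReducedWord SA SF true m) (hb : b ∈ SF false) : ReducedWord SA SF false (m * b) := by
  cases h with
  | inner _ _ hw => exact .outer _ ((AlternatingWord.single _ _ (hAF _ hw)).snoc true _ _ hb)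
  | outer_inner p w hp hw => exact .outer _ ((hp.snoc false _ _ (hAF _ hw)).snoc true _ _ hb)

/-- A functional vanishing on reduced words vanishes on every product of a reduced word with an
alternating list whose `false` letters split into an outer and an inner part. -/
theorem ReducedWord.map_mul_prod_eq_zero {SA SF T : Bool → Set M} {E : M →ₗ[ℂ] M}
    (hAF : ∀ w, AlternatingWord SA true w → w ∈ SF true)
    (hE : ∀ b m, ReducedWord SA SF b m → E m = 0) (htrue : T true ⊆ SA true)
    (hfalse : ∀ b ∈ T false, ∃ c ∈ SA false, b - c ∈ SF false)
    (l : List (Bool × M)) (hl : ∀ p ∈ l, p.2 ∈ T p.1) (b : Bool)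
    (hchain : (b :: l.map Prod.fst).IsChain (· ≠ ·)) (m : M) (hm : ReducedWord SA SF b m) :
    E (m * (l.map Prod.snd).prod) = 0 := by
  induction l generalizing b m with
  | nil => simpa using hE b m hm
  | cons p l ih =>
    obtain ⟨β, x⟩ := p
    have hx : x ∈ T β := hl (β, x) (by simp)
    have ih := ih fun p hp => hl p (List.mem_cons_of_mem _ hp)
    rw [List.map_cons, List.isChain_cons_cons] at hchain
    obtain ⟨hne, hchain⟩ := hchain
    rw [List.map_cons, List.prod_cons, ← mul_assoc]
    cases b <;> cases β <;> simp only [ne_eq, not_true_eq_false] at hne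
    · exact ih _ hchain _ (hm.mul_true (htrue hx))
    · obtain ⟨c, hc, hxc⟩ := hfalse x hx
      have h₁ := ih _ hchain _ (hm.mul_inner hc)
      have h₂ := ih _ hchain _ (hm.mul_outer hAF hxc)
      rw [← sub_add_cancel x c, mul_add, add_mul, map_add, h₁, h₂, add_zero]

theorem free_over_D_of_free_over_C_and_free_over_D
    (N D C B : Subalgebra ℂ M) (hDC : D ≤ C) (hCB : C ≤ B)
    (ED EC EB : M →ₗ[ℂ] M)
    (hED : IsCondExp D ED) (hEC : IsCondExp C EC) (hEB : IsCondExp B EB)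
    (hDCcomp : ED ∘ₗ EC = ED) (hCBcomp : EC ∘ₗ EB = EC)
    (hfaithCB : ∀ b₁ ∈ B, (∀ b₂ ∈ B, EC (b₁ * b₂) = 0) → b₁ = 0)
    (hfaithDC : ∀ c₁ ∈ C, (∀ c₂ ∈ C, ED (c₁ * c₂) = 0) → c₁ = 0)
    (hfaithDB : ∀ b₁ ∈ B, (∀ b₂ ∈ B, ED (b₁ * b₂) = 0) → b₁ = 0)
    (hfree₁ : IsFreeWithAmalgamation ED ((N ⊔ D : Subalgebra ℂ M) : Set M) (C : Set M))
    (hfree₂ : IsFreeWithAmalgamation EC ((N ⊔ C : Subalgebra ℂ M) : Set M) (B : Set M)) :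
    IsFreeWithAmalgamation ED ((N ⊔ D : Subalgebra ℂ M) : Set M) (B : Set M) := by
  set SA := centered ED ((N ⊔ D : Subalgebra ℂ M) : Set M) (C : Set M)
  set SF := centered EC ((N ⊔ C : Subalgebra ℂ M) : Set M) (B : Set M)
  set T := centered ED ((N ⊔ D : Subalgebra ℂ M) : Set M) (B : Set M)
  have hmem : ∀ b, SA b ⊆ (N ⊔ C : Subalgebra ℂ M) := by
    rintro (_ | _) x ⟨hx, -⟩
    · exact (le_sup_right : C ≤ N ⊔ C) (by simpa using hx)
    · exact sup_le_sup_left hDC N (by simpa using hx)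
  have hEC₀ : ∀ w, AlternatingWord SA true w → EC w = 0 := fun w hw =>
    hfree₁.map_eq_zero_of_ends_true hDC hED hEC hDCcomp hfaithDC hw
  have hAF : ∀ w, AlternatingWord SA true w → w ∈ SF true := fun w hw =>
    ⟨by simpa using hw.mem_subalgebra hmem, hEC₀ w hw⟩
  have hF : ∀ b m, AlternatingWord SF b m → ED m = 0 := fun b m hm => by
    rw [← LinearMap.congr_fun hDCcomp m, LinearMap.comp_apply, hfree₂.map_eq_zero hm, map_zero]
  have hE : ∀ b m, ReducedWord SA SF b m → ED m = 0 := by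
    intro b m hm
    cases hm with
    | inner _ _ hw => exact hfree₁.map_eq_zero hw
    | outer _ hp => exact hF _ _ hp
    | outer_inner p w hp hw => exact hF _ _ (hp.snoc false _ _ (hAF w hw))
    | outer_inner_snoc p w c hp hw hc =>
      refine hF _ _ (hp.snoc false _ _ ⟨?_, ?_⟩)
      · simpa using (N ⊔ C).mul_mem (hw.mem_subalgebra hmem) (hmem _ hc)
      · rw [hEC.map_mul_right_s6 w (by simpa using hc.1), hEC₀ w hw, zero_mul]
  have hfalse : ∀ b ∈ T false, ∃ c ∈ SA false, b - c ∈ SF false := fun b hb =>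
    have h := sub_map_mem_centered hCB hEC hDCcomp hb
    ⟨EC b, h.2, h.1⟩
  intro k hk a f ha ha₀ hf
  obtain ⟨k, rfl⟩ : ∃ j, k = j + 1 := ⟨k - 1, by omega⟩
  have hT₀ : a 0 ∈ T (f 0) := ⟨ha 0, ha₀ 0⟩
  have hchain : (f 0 :: (List.ofFn fun j : Fin k => (f j.succ, a j.succ)).map Prod.fst).IsChain
      (· ≠ ·) := by
    have h : (List.ofFn f).IsChain (· ≠ ·) :=
      List.isChain_iff_getElem.2 fun i hi => by
        simpa [-List.ofFn_succ] using hf i (by simpa using hi)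
    simpa [List.ofFn_succ, List.map_ofFn, Function.comp_def] using h
  have hl : ∀ p ∈ List.ofFn fun j : Fin k => (f j.succ, a j.succ), p.2 ∈ T p.1 := by
    intro p hp
    obtain ⟨j, rfl⟩ := (List.mem_ofFn' _ _).1 hp
    exact ⟨ha _, ha₀ _⟩
  have key := ReducedWord.map_mul_prod_eq_zero hAF hE (T := T) (fun _ h => h) hfalse _ hl _ hchain
  have hprod : (List.ofFn a).prod =
      a 0 * ((List.ofFn fun j : Fin k => (f j.succ, a j.succ)).map Prod.snd).prod := by
    simp [List.ofFn_succ, List.map_ofFn, Function.comp_def]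
  rw [hprod]
  cases hf₀ : f 0 with
  | true =>
    rw [hf₀] at hT₀ key
    exact key _ (.inner _ _ (.single _ _ hT₀))
  | false =>
    rw [hf₀] at hT₀ key
    obtain ⟨c, hc, hac⟩ := hfalse _ hT₀
    rw [← sub_add_cancel (a 0) c, add_mul, map_add,
      key _ (.inner _ _ (.single _ _ hc)), key _ (.outer _ (.single _ _ hac)), add_zero]

end OVD
end
end
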